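/- arXiv:2601.07545 — 8 statements merged into one kernel-verified Lean document; each statement's English description precedes it below -/
import Mathlib

section
/- Let X ∈ ℝ^{n×d} with X^⊤X invertible, let Y ∈ ℝ^n, let θ* := (X^⊤X)^{-1}X^⊤Y be the OLS solution, and let (X,Y) ∈ ℝ^{n×(d+1)} denote the matrix obtained from X by appending Y as an additional column. Then λ_min((X,Y)^⊤(X,Y)) ≤ ‖Y − Xθ*‖² / (1 + ‖θ*‖²). -/
open Matrix

/-- The smallest eigenvalue of a real symmetric matrix, characterized as the infimum of
`v ⬝ᵥ M *ᵥ v` over (Euclidean) unit vectors `v`. -/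
noncomputable def lambdaMin {d : ℕ} (M : Matrix (Fin d) (Fin d) ℝ) : ℝ :=
  sInf {r : ℝ | ∃ v : Fin d → ℝ, v ⬝ᵥ v = 1 ∧ r = v ⬝ᵥ (M *ᵥ v)}

theorem dotProduct_transpose_mul_self_mulVec {m k : ℕ} (A : Matrix (Fin m) (Fin k) ℝ)
    (v : Fin k → ℝ) : v ⬝ᵥ ((Aᵀ * A) *ᵥ v) = (A *ᵥ v) ⬝ᵥ (A *ᵥ v) := by
  rw [← mulVec_mulVec, dotProduct_mulVec, vecMul_transpose]

/-- The Rayleigh quotient of a nonzero vector bounds `lambdaMin` of a Gram matrix. -/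
theorem lambdaMin_transpose_mul_self_le {m k : ℕ} (A : Matrix (Fin m) (Fin k) ℝ)
    (w : Fin k → ℝ) (hw : 0 < w ⬝ᵥ w) :
    lambdaMin (Aᵀ * A) ≤ ((A *ᵥ w) ⬝ᵥ (A *ᵥ w)) / (w ⬝ᵥ w) := by
  have hsq : (√(w ⬝ᵥ w))⁻¹ * (√(w ⬝ᵥ w))⁻¹ = (w ⬝ᵥ w)⁻¹ := by
    rw [← mul_inv, Real.mul_self_sqrt hw.le]
  refine csInf_le ⟨0, ?_⟩ ⟨(√(w ⬝ᵥ w))⁻¹ • w, ?_, ?_⟩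
  · rintro r ⟨v, -, rfl⟩
    rw [dotProduct_transpose_mul_self_mulVec]
    exact Finset.sum_nonneg fun i _ => mul_self_nonneg _
  · rw [smul_dotProduct, dotProduct_smul, smul_smul, hsq, smul_eq_mul, inv_mul_cancel₀ hw.ne']
  · rw [dotProduct_transpose_mul_self_mulVec, mulVec_smul, smul_dotProduct, dotProduct_smul,
      smul_smul, hsq, smul_eq_mul, div_eq_inv_mul]

/-- with `θ* = (XᵀX)⁻¹XᵀY` the OLS solution,
`λ_min((X,Y)ᵀ(X,Y)) ≤ ‖Y − Xθ*‖² / (1 + ‖θ*‖²)`. -/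
theorem stmt1 {n d : ℕ} (X : Matrix (Fin n) (Fin d) ℝ) (Y : Fin n → ℝ)
    (hX : IsUnit (Xᵀ * X).det) :
    let θ : Fin d → ℝ := (Xᵀ * X)⁻¹ *ᵥ (Xᵀ *ᵥ Y)
    let XY : Matrix (Fin n) (Fin (d + 1)) ℝ := Matrix.of fun i => Fin.snoc (X i) (Y i)
    lambdaMin (XYᵀ * XY) ≤ ((Y - X *ᵥ θ) ⬝ᵥ (Y - X *ᵥ θ)) / (1 + θ ⬝ᵥ θ) := by
  intro θ XY
  set w : Fin (d + 1) → ℝ := Fin.snoc (-θ) 1 with hw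
  have hww : w ⬝ᵥ w = 1 + θ ⬝ᵥ θ := by
    simp [hw, dotProduct, Fin.sum_univ_castSucc, add_comm]
  have hXYw : XY *ᵥ w = Y - X *ᵥ θ := by
    ext i
    simp [XY, hw, mulVec, dotProduct, Fin.sum_univ_castSucc]
    ring
  have hθ : 0 ≤ θ ⬝ᵥ θ := Finset.sum_nonneg fun i _ => mul_self_nonneg _
  have h := lambdaMin_transpose_mul_self_le XY w (by linarith)
  rwa [hXYw, hww] at h
end

section
/- Let a > 0, let A ∈ ℝ^{n×d} with A^⊤A invertible, and let b ∈ ℝ^n. Define θ*(A,b) := (A^⊤A)^{-1}A^⊤b and θ*(A,b;a) := (A^⊤A + a·I_d)^{-1}A^⊤b. Then ‖θ*(A,b;a) − θ*(A,b)‖²_{A^⊤A + a·I_d} ≤ a·‖θ*(A,b)‖². -/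
open Matrix

/-- with `θ*(A,b) = (AᵀA)⁻¹Aᵀb` and `θ*(A,b;a) = (AᵀA + a·I)⁻¹Aᵀb`,
`‖θ*(A,b;a) − θ*(A,b)‖²_{AᵀA + a·I} ≤ a·‖θ*(A,b)‖²`. -/
theorem stmt2 {n d : ℕ} (a : ℝ) (ha : 0 < a)
    (A : Matrix (Fin n) (Fin d) ℝ) (b : Fin n → ℝ) (hA : IsUnit (Aᵀ * A).det) :
    let θ : Fin d → ℝ := (Aᵀ * A)⁻¹ *ᵥ (Aᵀ *ᵥ b)
    let θa : Fin d → ℝ := (Aᵀ * A + a • (1 : Matrix (Fin d) (Fin d) ℝ))⁻¹ *ᵥ (Aᵀ *ᵥ b)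
    (θa - θ) ⬝ᵥ ((Aᵀ * A + a • (1 : Matrix (Fin d) (Fin d) ℝ)) *ᵥ (θa - θ)) ≤ a * (θ ⬝ᵥ θ) := by
  intro θ θa
  have hG : (Aᵀ * A).PosSemidef := by
    simpa using Matrix.posSemidef_conjTranspose_mul_self A
  have hM : IsUnit (Aᵀ * A + a • (1 : Matrix (Fin d) (Fin d) ℝ)).det :=
    (Matrix.isUnit_iff_isUnit_det _).mp
      (Matrix.PosDef.posSemidef_add hG (Matrix.PosDef.one.smul ha)).isUnit
  have hθ : (Aᵀ * A) *ᵥ θ = Aᵀ *ᵥ b := by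
    rw [Matrix.mulVec_mulVec, Matrix.mul_nonsing_inv _ hA, Matrix.one_mulVec]
  have hθa : (Aᵀ * A + a • (1 : Matrix (Fin d) (Fin d) ℝ)) *ᵥ θa = Aᵀ *ᵥ b := by
    rw [Matrix.mulVec_mulVec, Matrix.mul_nonsing_inv _ hM, Matrix.one_mulVec]
  generalize θa = x at *
  generalize θ = t at *
  have hres : (Aᵀ * A + a • (1 : Matrix (Fin d) (Fin d) ℝ)) *ᵥ (x - t) = -(a • t) := by
    rw [Matrix.mulVec_sub, hθa, Matrix.add_mulVec, hθ, Matrix.smul_mulVec, Matrix.one_mulVec]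
    abel
  have hsplit : (x - t) ⬝ᵥ ((Aᵀ * A) *ᵥ (x - t)) + a * ((x - t) ⬝ᵥ (x - t))
      = -(a * ((x - t) ⬝ᵥ t)) := by
    have h := congrArg (fun v => (x - t) ⬝ᵥ v) hres
    simpa only [Matrix.add_mulVec, Matrix.smul_mulVec, Matrix.one_mulVec, dotProduct_add,
      dotProduct_smul, dotProduct_neg, smul_eq_mul] using h
  have hnonneg : 0 ≤ (x - t) ⬝ᵥ ((Aᵀ * A) *ᵥ (x - t)) := by
    simpa using hG.dotProduct_mulVec_nonneg (x - t)
  have hsq : 0 ≤ a * ((x - t + t) ⬝ᵥ (x - t + t)) :=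
    mul_nonneg ha.le (Finset.sum_nonneg fun i _ => mul_self_nonneg _)
  rw [add_dotProduct, dotProduct_add, dotProduct_add, dotProduct_comm t (x - t)] at hsq
  rw [hres, dotProduct_neg, dotProduct_smul, smul_eq_mul]
  linarith
end

section
/- Let a > 0, let A ∈ ℝ^{n×d} with A^⊤A invertible, and let b ∈ ℝ^n. Define θ*(A,b) := (A^⊤A)^{-1}A^⊤b and θ*(A,b;a) := (A^⊤A + a·I_d)^{-1}A^⊤b. Then the following exact identity holds: a·‖θ*(A,b)‖² = a·‖θ*(A,b;a)‖² + ‖θ*(A,b;a) − θ*(A,b)‖²_{A^⊤A} + ‖θ*(A,b;a) − θ*(A,b)‖²_{A^⊤A + a·I_d}. -/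
open Matrix

/-- If `M θ = v` and `(M + a I) θa = v`, then `a ‖θ‖²` splits as `a ‖θa‖²` plus the squared
seminorms of `θa - θ` with respect to `M` and `M + a I`. -/
theorem mul_dotProduct_self_eq_of_mulVec_eq {ι R : Type*} [Fintype ι] [DecidableEq ι] [CommRing R]
    {M : Matrix ι ι R} {a : R} {v θ θa : ι → R} (hθ : M *ᵥ θ = v)
    (hθa : (M + a • (1 : Matrix ι ι R)) *ᵥ θa = v) :
    a * (θ ⬝ᵥ θ) =
      a * (θa ⬝ᵥ θa) + (θa - θ) ⬝ᵥ (M *ᵥ (θa - θ)) +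
        (θa - θ) ⬝ᵥ ((M + a • (1 : Matrix ι ι R)) *ᵥ (θa - θ)) := by
  have hM : M *ᵥ (θa - θ) = -(a • θa) := by
    rw [add_mulVec, smul_mulVec, one_mulVec] at hθa
    rw [mulVec_sub, hθ, ← hθa]
    abel
  have hMa : (M + a • (1 : Matrix ι ι R)) *ᵥ (θa - θ) = -(a • θ) := by
    rw [mulVec_sub, hθa, add_mulVec, smul_mulVec, one_mulVec, hθ]
    abel
  rw [hM, hMa]
  simp only [dotProduct_neg, dotProduct_smul, sub_dotProduct, smul_eq_mul, dotProduct_comm θ θa]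
  ring

/-- with `θ*(A,b) = (AᵀA)⁻¹Aᵀb` and `θ*(A,b;a) = (AᵀA + a·I)⁻¹Aᵀb`, the exact
identity `a·‖θ*(A,b)‖² = a·‖θ*(A,b;a)‖² + ‖θ*(A,b;a) − θ*(A,b)‖²_{AᵀA}
+ ‖θ*(A,b;a) − θ*(A,b)‖²_{AᵀA + a·I}` holds. -/
theorem stmt3 {n d : ℕ} (a : ℝ) (ha : 0 < a)
    (A : Matrix (Fin n) (Fin d) ℝ) (b : Fin n → ℝ) (hA : IsUnit (Aᵀ * A).det) :
    let θ : Fin d → ℝ := (Aᵀ * A)⁻¹ *ᵥ (Aᵀ *ᵥ b)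
    let θa : Fin d → ℝ := (Aᵀ * A + a • (1 : Matrix (Fin d) (Fin d) ℝ))⁻¹ *ᵥ (Aᵀ *ᵥ b)
    a * (θ ⬝ᵥ θ) =
      a * (θa ⬝ᵥ θa) + (θa - θ) ⬝ᵥ ((Aᵀ * A) *ᵥ (θa - θ)) +
        (θa - θ) ⬝ᵥ ((Aᵀ * A + a • (1 : Matrix (Fin d) (Fin d) ℝ)) *ᵥ (θa - θ)) := by
  have hMa : (Aᵀ * A + a • (1 : Matrix (Fin d) (Fin d) ℝ)).PosDef := by
    refine Matrix.PosDef.posSemidef_add ?_ (Matrix.PosDef.one.smul ha)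
    simpa using Matrix.posSemidef_conjTranspose_mul_self A
  apply mul_dotProduct_self_eq_of_mulVec_eq (v := Aᵀ *ᵥ b)
  · rw [mulVec_mulVec, mul_nonsing_inv _ hA, one_mulVec]
  · rw [mulVec_mulVec, mul_nonsing_inv _ ((isUnit_iff_isUnit_det _).1 hMa.isUnit), one_mulVec]
end

section
/- Let ξ be a random vector in ℝ^d whose entries are independent standard Gaussian random variables (i.e. ξ is distributed according to the d-fold product of the standard Gaussian measure on ℝ), and let ϱ ∈ (0,1]. Then P( ‖ξ‖² ≤ (√(2d) + √(4·log(1/ϱ)))² ) ≥ 1 − ϱ². -/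
open MeasureTheory ProbabilityTheory

/-- The moment generating function of the square of a standard Gaussian variable. -/
lemma integral_exp_mul_sq_gaussianReal {t : ℝ} (ht : t < 1 / 2) :
    ∫ x, Real.exp (t * x ^ 2) ∂(gaussianReal 0 1) = (Real.sqrt (1 - 2 * t))⁻¹ := by
  have hb : 0 < 1 - 2 * t := by linarith
  have hdensity : ∀ x : ℝ, gaussianPDFReal 0 1 x • Real.exp (t * x ^ 2) =
      (Real.sqrt (2 * Real.pi))⁻¹ * Real.exp (-((1 - 2 * t) / 2) * x ^ 2) := by
    intro x
    rw [gaussianPDFReal, smul_eq_mul, mul_assoc, ← Real.exp_add]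
    simp only [NNReal.coe_one, mul_one, sub_zero]
    ring_nf
  rw [integral_gaussianReal_eq_integral_smul one_ne_zero]
  simp_rw [hdensity]
  rw [integral_const_mul, integral_gaussian, ← Real.sqrt_inv, ← Real.sqrt_inv,
    ← Real.sqrt_mul (by positivity)]
  congr 1
  field_simp

lemma integrable_exp_mul_sq_gaussianReal {t : ℝ} (ht : t < 1 / 2) :
    Integrable (fun x => Real.exp (t * x ^ 2)) (gaussianReal 0 1) := by
  refine Integrable.of_integral_ne_zero ?_
  rw [integral_exp_mul_sq_gaussianReal ht]
  have : 0 < 1 - 2 * t := by linarith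
  positivity

lemma inv_sqrt_le_exp (u : ℝ) :
    (Real.sqrt u)⁻¹ ≤ Real.exp ((u⁻¹ - 1) / 2) := by
  rw [← Real.sqrt_inv, Real.exp_half]
  gcongr
  linarith [Real.add_one_le_exp (u⁻¹ - 1)]

/-- Chernoff's bound for the squared norm of a standard Gaussian vector. -/
lemma measureReal_pi_gaussianReal_le_sum_sq (d : ℕ) (ε : ℝ) {t : ℝ} (ht₀ : 0 ≤ t)
    (ht : t < 1 / 2) :
    (Measure.pi fun _ : Fin d => gaussianReal 0 1).real {x : Fin d → ℝ | ε ≤ ∑ i, (x i) ^ 2} ≤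
      Real.exp (-t * ε + d * (((1 - 2 * t)⁻¹ - 1) / 2)) := by
  have hprod : ∀ x : Fin d → ℝ,
      Real.exp (t * ∑ i, (x i) ^ 2) = ∏ i, Real.exp (t * (x i) ^ 2) := by
    intro x
    rw [Finset.mul_sum, Real.exp_sum]
  refine (measure_ge_le_exp_mul_mgf ε ht₀ ?_).trans ?_
  · simp_rw [hprod]
    exact Integrable.fintype_prod fun _ => integrable_exp_mul_sq_gaussianReal ht
  · rw [Real.exp_add, mgf]
    simp_rw [hprod]
    rw [integral_fintype_prod_eq_pow (fun x : ℝ => Real.exp (t * x ^ 2)),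
      integral_exp_mul_sq_gaussianReal ht, Fintype.card_fin, Real.exp_nat_mul]
    gcongr
    exact inv_sqrt_le_exp _

/-- if `ξ` is a standard Gaussian vector in `ℝ^d` (the `d`-fold product of the
standard Gaussian measure on `ℝ`) and `ϱ ∈ (0,1]`, then
`P(‖ξ‖² ≤ (√(2d) + √(4·log(1/ϱ)))²) ≥ 1 − ϱ²`. -/
theorem stmt6 (d : ℕ) (ϱ : ℝ) (hϱ : ϱ ∈ Set.Ioc (0 : ℝ) 1) :
    ENNReal.ofReal (1 - ϱ ^ 2) ≤
      (Measure.pi fun _ : Fin d => gaussianReal 0 1)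
        {x : Fin d → ℝ |
          ∑ i, (x i) ^ 2 ≤ (Real.sqrt (2 * d) + Real.sqrt (4 * Real.log (1 / ϱ))) ^ 2} := by
  obtain ⟨hpos, hle⟩ := hϱ
  have hlog : 0 ≤ Real.log (1 / ϱ) := Real.log_nonneg (by rw [le_div_iff₀ hpos]; linarith)
  have ha : Real.sqrt (2 * d) ^ 2 = 2 * d := Real.sq_sqrt (by positivity)
  have hb : Real.sqrt (4 * Real.log (1 / ϱ)) ^ 2 = 4 * Real.log (1 / ϱ) :=
    Real.sq_sqrt (by positivity)
  have hb₀ : 0 ≤ Real.sqrt (4 * Real.log (1 / ϱ)) := Real.sqrt_nonneg _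
  rcases Nat.eq_zero_or_pos d with rfl | hd
  · have huniv : {x : Fin 0 → ℝ | ∑ i, (x i) ^ 2 ≤
        (Real.sqrt (2 * (0 : ℕ)) + Real.sqrt (4 * Real.log (1 / ϱ))) ^ 2} = Set.univ :=
      Set.eq_univ_of_forall fun x => by
        rw [Set.mem_ofPred_eq, Fin.sum_univ_zero]
        positivity
    rw [huniv, measure_univ, ENNReal.ofReal_le_one]
    nlinarith
  have ha₀ : 0 < Real.sqrt (2 * d) := by positivity
  set a := Real.sqrt (2 * d)
  set b := Real.sqrt (4 * Real.log (1 / ϱ))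
  have hsum : 0 < a + b := by positivity
  have hchernoff := measureReal_pi_gaussianReal_le_sum_sq d ((a + b) ^ 2)
    (t := b / (2 * (a + b))) (by positivity)
    (by rw [div_lt_div_iff₀ (by positivity) (by norm_num)]; linarith)
  have hinv : (1 - 2 * (b / (2 * (a + b))))⁻¹ = (a + b) / a := by
    rw [show 1 - 2 * (b / (2 * (a + b))) = a / (a + b) by field_simp; ring, inv_div]
  have hexponent : -(b / (2 * (a + b))) * (a + b) ^ 2 +
      d * (((1 - 2 * (b / (2 * (a + b))))⁻¹ - 1) / 2) ≤ 2 * Real.log ϱ := by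
    have hd' : (d : ℝ) = a ^ 2 / 2 := by linarith
    have hlog' : 2 * Real.log ϱ = -(b ^ 2 / 2) := by
      rw [hb, one_div, Real.log_inv]
      ring
    rw [hinv, hd', hlog', show -(b / (2 * (a + b))) * (a + b) ^ 2 +
      a ^ 2 / 2 * (((a + b) / a - 1) / 2) = -(b ^ 2 / 2) - a * b / 4 by field_simp; ring]
    linarith [mul_nonneg ha₀.le hb₀]
  have htail : (Measure.pi fun _ : Fin d => gaussianReal 0 1).real
      {x : Fin d → ℝ | (a + b) ^ 2 ≤ ∑ i, (x i) ^ 2} ≤ ϱ ^ 2 := by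
    refine hchernoff.trans ((Real.exp_le_exp.2 hexponent).trans_eq ?_)
    rw [two_mul, Real.exp_add, Real.exp_log hpos, sq]
  have hmeas : MeasurableSet {x : Fin d → ℝ | ∑ i, (x i) ^ 2 ≤ (a + b) ^ 2} :=
    measurableSet_le (by fun_prop) measurable_const
  rw [← ofReal_measureReal]
  apply ENNReal.ofReal_le_ofReal
  have hcompl := probReal_compl_eq_one_sub
    (μ := Measure.pi fun _ : Fin d => gaussianReal 0 1) hmeas
  have hmono : (Measure.pi fun _ : Fin d => gaussianReal 0 1).real
      {x : Fin d → ℝ | ∑ i, (x i) ^ 2 ≤ (a + b) ^ 2}ᶜ ≤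
      (Measure.pi fun _ : Fin d => gaussianReal 0 1).real
        {x : Fin d → ℝ | (a + b) ^ 2 ≤ ∑ i, (x i) ^ 2} :=
    measureReal_mono fun x hx => by
      simp only [Set.mem_compl_iff, Set.mem_ofPred_eq, not_le] at hx ⊢
      exact hx.le
  linarith
end

section
/- Let χ ∈ (0,1], k ∈ ℕ with k ≥ 1, A ∈ ℝ^{n×d} with A^⊤A positive definite, and B ∈ ℝ^{k×n} satisfying |u^⊤((1/k)·B^⊤B − I_n)Av| ≤ (χ/2)·‖u‖·‖Av‖ for all u ∈ ℝ^n and v ∈ ℝ^d. Then (1/k)·(BA)^⊤(BA) is positive definite and, in the Loewner order, (1/(1+χ/2))·(A^⊤A)^{-1} ⪯ ((1/k)·(BA)^⊤(BA))^{-1} ⪯ (1/(1−χ/2))·(A^⊤A)^{-1}. -/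
open Matrix

/-- Sketching condition `A₁(A,χ,k)`:
`|uᵀ((1/k)·BᵀB − I)Av| ≤ (χ/2)·‖u‖·‖Av‖` for all `u, v`. -/
def condA1 {κ m δ : Type*} [Fintype κ] [Fintype m] [DecidableEq m] [Fintype δ]
    (A : Matrix m δ ℝ) (χ : ℝ) (k : ℕ) (B : Matrix κ m ℝ) : Prop :=
  ∀ (u : m → ℝ) (v : δ → ℝ),
    |u ⬝ᵥ ((((k : ℝ)⁻¹ • (Bᵀ * B)) - 1) *ᵥ (A *ᵥ v))| ≤
      (χ / 2) * Real.sqrt (u ⬝ᵥ u) * Real.sqrt ((A *ᵥ v) ⬝ᵥ (A *ᵥ v))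

/-- Matrix inversion reverses the Loewner order on positive definite matrices. -/
theorem Matrix.PosDef.posSemidef_inv_sub_inv {ι : Type*} [Fintype ι] [DecidableEq ι]
    {M N : Matrix ι ι ℝ} (hM : M.PosDef) (hN : N.PosDef) (h : (N - M).PosSemidef) :
    (M⁻¹ - N⁻¹).PosSemidef := by
  have hMu : IsUnit M.det := (Matrix.isUnit_iff_isUnit_det M).1 hM.isUnit
  have hNu : IsUnit N.det := (Matrix.isUnit_iff_isUnit_det N).1 hN.isUnit
  have key : M⁻¹ - N⁻¹ =
      (M⁻¹ - N⁻¹)ᴴ * M * (M⁻¹ - N⁻¹) + (N⁻¹)ᴴ * (N - M) * N⁻¹ := by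
    rw [Matrix.conjTranspose_sub, hM.isHermitian.inv.eq, hN.isHermitian.inv.eq]
    simp only [sub_mul, mul_sub, Matrix.nonsing_inv_mul M hMu, Matrix.nonsing_inv_mul N hNu,
      one_mul, Matrix.mul_assoc, Matrix.mul_nonsing_inv M hMu, mul_one]
    abel
  rw [key]
  exact (hM.posSemidef.conjTranspose_mul_mul_same _).add (h.conjTranspose_mul_mul_same _)

/-- Under `condA1`, the quadratic form of `(1/k)·(BA)ᵀ(BA)` differs from that of `AᵀA` by at most
a factor `χ / 2`. -/
theorem condA1.abs_quadratic_sub_le {κ m δ : Type*} [Fintype κ] [Fintype m] [DecidableEq m]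
    [Fintype δ] {A : Matrix m δ ℝ} {χ : ℝ} {k : ℕ} {B : Matrix κ m ℝ} (hB : condA1 A χ k B)
    (v : δ → ℝ) :
    |v ⬝ᵥ (((k : ℝ)⁻¹ • ((B * A)ᵀ * (B * A))) *ᵥ v) - v ⬝ᵥ ((Aᵀ * A) *ᵥ v)| ≤
      χ / 2 * (v ⬝ᵥ ((Aᵀ * A) *ᵥ v)) := by
  have hAA : v ⬝ᵥ ((Aᵀ * A) *ᵥ v) = (A *ᵥ v) ⬝ᵥ (A *ᵥ v) := by
    rw [← Matrix.mulVec_mulVec, Matrix.dotProduct_mulVec, Matrix.vecMul_transpose]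
  have hBA : v ⬝ᵥ (((k : ℝ)⁻¹ • ((B * A)ᵀ * (B * A))) *ᵥ v) =
      (A *ᵥ v) ⬝ᵥ (((k : ℝ)⁻¹ • (Bᵀ * B)) *ᵥ (A *ᵥ v)) := by
    rw [← Matrix.vecMul_transpose A v, ← Matrix.dotProduct_mulVec, Matrix.vecMul_transpose,
      Matrix.mulVec_mulVec, Matrix.mulVec_mulVec]
    simp only [Matrix.transpose_mul, Matrix.mul_smul, Matrix.smul_mul, Matrix.mul_assoc]
  have h := hB (A *ᵥ v) v
  have hnn : 0 ≤ (A *ᵥ v) ⬝ᵥ (A *ᵥ v) := Finset.sum_nonneg fun i _ => mul_self_nonneg _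
  rw [mul_assoc, Real.mul_self_sqrt hnn, Matrix.sub_mulVec, Matrix.one_mulVec,
    dotProduct_sub] at h
  rwa [hAA, hBA]

/-- under condition `A₁(A,χ,k)`, the matrix `(1/k)·(BA)ᵀ(BA)` is positive
definite and, in the Loewner order,
`(1/(1+χ/2))·(AᵀA)⁻¹ ⪯ ((1/k)·(BA)ᵀ(BA))⁻¹ ⪯ (1/(1−χ/2))·(AᵀA)⁻¹`. -/
theorem stmt7 {n d k : ℕ} (hk : 1 ≤ k) (χ : ℝ) (hχ : χ ∈ Set.Ioc (0 : ℝ) 1)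
    (A : Matrix (Fin n) (Fin d) ℝ) (hA : (Aᵀ * A).PosDef)
    (B : Matrix (Fin k) (Fin n) ℝ) (hB : condA1 A χ k B) :
    ((k : ℝ)⁻¹ • ((B * A)ᵀ * (B * A))).PosDef ∧
      ((((k : ℝ)⁻¹ • ((B * A)ᵀ * (B * A)))⁻¹ - (1 + χ / 2)⁻¹ • (Aᵀ * A)⁻¹).PosSemidef ∧
        ((1 - χ / 2)⁻¹ • (Aᵀ * A)⁻¹ - ((k : ℝ)⁻¹ • ((B * A)ᵀ * (B * A)))⁻¹).PosSemidef) := by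
  obtain ⟨hχ0, hχ1⟩ := hχ
  set G := Aᵀ * A
  set S := (k : ℝ)⁻¹ • ((B * A)ᵀ * (B * A)) with hS
  have hSH : S.IsHermitian := by
    simp [Matrix.IsHermitian, hS, Matrix.conjTranspose_eq_transpose_of_trivial]
  have hpos : ∀ v : Fin d → ℝ, v ≠ 0 → 0 < v ⬝ᵥ (G *ᵥ v) := fun v hv => by
    simpa using hA.dotProduct_mulVec_pos hv
  have hbd : ∀ v, -(χ / 2 * (v ⬝ᵥ (G *ᵥ v))) ≤ v ⬝ᵥ (S *ᵥ v) - v ⬝ᵥ (G *ᵥ v) ∧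
      v ⬝ᵥ (S *ᵥ v) - v ⬝ᵥ (G *ᵥ v) ≤ χ / 2 * (v ⬝ᵥ (G *ᵥ v)) :=
    fun v => abs_le.1 (hB.abs_quadratic_sub_le v)
  have hquad : ∀ (c : ℝ) (v : Fin d → ℝ), v ⬝ᵥ ((c • G) *ᵥ v) = c * (v ⬝ᵥ (G *ᵥ v)) :=
    fun c v => by rw [Matrix.smul_mulVec, dotProduct_smul, smul_eq_mul]
  have hSpd : S.PosDef := .of_dotProduct_mulVec_pos hSH fun v hv => by
    have := hpos v hv
    have := (hbd v).1
    rw [star_trivial]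
    nlinarith
  have hsmul : ∀ c : ℝ, 0 < c → c⁻¹ • G⁻¹ = (c • G)⁻¹ := fun c hc => by
    have := invertibleOfNonzero hc.ne'
    rw [Matrix.inv_smul G c ((Matrix.isUnit_iff_isUnit_det G).1 hA.isUnit), invOf_eq_inv]
  have hc₁ : 0 < 1 + χ / 2 := by linarith
  have hc₂ : 0 < 1 - χ / 2 := by linarith
  refine ⟨hSpd, ?_, ?_⟩
  · rw [hsmul _ hc₁]
    refine hSpd.posSemidef_inv_sub_inv (hA.smul hc₁) <|
      .of_dotProduct_mulVec_nonneg ((hA.smul hc₁).isHermitian.sub hSH) fun v => ?_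
    have := (hbd v).2
    rw [star_trivial, Matrix.sub_mulVec, dotProduct_sub, hquad]
    linarith
  · rw [hsmul _ hc₂]
    refine (hA.smul hc₂).posSemidef_inv_sub_inv hSpd <|
      .of_dotProduct_mulVec_nonneg (hSH.sub (hA.smul hc₂).isHermitian) fun v => ?_
    have := (hbd v).1
    rw [star_trivial, Matrix.sub_mulVec, dotProduct_sub, hquad]
    linarith
end

section
/- Let χ ∈ (0,1], k ∈ ℕ with k ≥ 1, A ∈ ℝ^{n×d} with A^⊤A positive definite, and B ∈ ℝ^{k×n} satisfying |u^⊤((1/k)·B^⊤B − I_n)Av| ≤ (χ/2)·‖u‖·‖Av‖ for all u ∈ ℝ^n and v ∈ ℝ^d. Then (BA)^⊤(BA) is invertible and for every vector v ∈ ℝ^d, k² · ‖((BA)^⊤(BA))^{-1} v‖²_{A^⊤A} ≤ (1/(1 − χ/2)²) · ‖v‖² / λ_min(A^⊤A). -/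
open Matrix

/-- The infimum defining `lambdaMin` bounds the Rayleigh quotient from below. -/
lemma lambdaMin_mul_le {d : ℕ} {M : Matrix (Fin d) (Fin d) ℝ} (hM : M.PosSemidef)
    (w : Fin d → ℝ) : lambdaMin M * (w ⬝ᵥ w) ≤ w ⬝ᵥ (M *ᵥ w) := by
  rcases eq_or_ne w 0 with rfl | hw
  · simp
  have hpos : 0 < w ⬝ᵥ w := by simpa using dotProduct_star_self_pos_iff.mpr hw
  have hbdd : BddBelow {r : ℝ | ∃ v : Fin d → ℝ, v ⬝ᵥ v = 1 ∧ r = v ⬝ᵥ (M *ᵥ v)} := by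
    refine ⟨0, ?_⟩
    rintro r ⟨v, -, rfl⟩
    simpa using hM.dotProduct_mulVec_nonneg v
  have hs : Real.sqrt (w ⬝ᵥ w) * Real.sqrt (w ⬝ᵥ w) = w ⬝ᵥ w := Real.mul_self_sqrt hpos.le
  have hs0 : Real.sqrt (w ⬝ᵥ w) ≠ 0 := (Real.sqrt_pos.mpr hpos).ne'
  have hle : lambdaMin M ≤ (w ⬝ᵥ w)⁻¹ * (w ⬝ᵥ (M *ᵥ w)) := by
    refine csInf_le hbdd ⟨(Real.sqrt (w ⬝ᵥ w))⁻¹ • w, ?_, ?_⟩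
    · rw [smul_dotProduct, dotProduct_smul, smul_eq_mul, smul_eq_mul, ← mul_assoc, ← mul_inv, hs,
        inv_mul_cancel₀ hpos.ne']
    · rw [mulVec_smul, smul_dotProduct, dotProduct_smul, smul_eq_mul, smul_eq_mul, ← mul_assoc,
        ← mul_inv, hs]
  calc lambdaMin M * (w ⬝ᵥ w) ≤ ((w ⬝ᵥ w)⁻¹ * (w ⬝ᵥ (M *ᵥ w))) * (w ⬝ᵥ w) := by gcongr
    _ = w ⬝ᵥ (M *ᵥ w) := by field_simp

lemma isCompact_setOf_dotProduct_self_eq_one (d : ℕ) :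
    IsCompact {v : Fin d → ℝ | v ⬝ᵥ v = 1} := by
  refine (isCompact_Icc (a := fun _ : Fin d => (-1 : ℝ)) (b := fun _ => 1)).of_isClosed_subset
    (isClosed_eq (by fun_prop) continuous_const) fun v hv => ?_
  have habs : ∀ i, |v i| ≤ 1 := fun i => by
    rw [abs_le_one_iff_mul_self_le_one, ← (hv : v ⬝ᵥ v = 1)]
    exact Finset.single_le_sum (f := fun i => v i * v i) (fun j _ => mul_self_nonneg _)
      (Finset.mem_univ i)
  exact ⟨fun i => (abs_le.mp (habs i)).1, fun i => (abs_le.mp (habs i)).2⟩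

lemma lambdaMin_pos {d : ℕ} [NeZero d] {M : Matrix (Fin d) (Fin d) ℝ} (hM : M.PosDef) :
    0 < lambdaMin M := by
  have himage : {r : ℝ | ∃ v : Fin d → ℝ, v ⬝ᵥ v = 1 ∧ r = v ⬝ᵥ (M *ᵥ v)} =
      (fun v => v ⬝ᵥ (M *ᵥ v)) '' {v : Fin d → ℝ | v ⬝ᵥ v = 1} := by
    ext r
    simp [eq_comm]
  have hmem : lambdaMin M ∈ (fun v => v ⬝ᵥ (M *ᵥ v)) '' {v : Fin d → ℝ | v ⬝ᵥ v = 1} := by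
    rw [lambdaMin, himage]
    refine ((isCompact_setOf_dotProduct_self_eq_one d).image (by fun_prop)).sInf_mem ?_
    exact ⟨_, Pi.single 0 1, by simp, rfl⟩
  obtain ⟨v, hv, hval⟩ := hmem
  have hv0 : v ≠ 0 := by
    rintro rfl
    simp at hv
  rw [← hval]
  simpa using hM.dotProduct_mulVec_pos hv0

/-- The sketched Gram matrix dominates `k (1 - χ/2)` times the Gram matrix. -/
lemma condA1.gram_le {κ m δ : Type*} [Fintype κ] [Fintype m] [DecidableEq m] [Fintype δ]
    {A : Matrix m δ ℝ} {χ : ℝ} {k : ℕ} {B : Matrix κ m ℝ} (hB : condA1 A χ k B) (hk : 1 ≤ k)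
    (w : δ → ℝ) :
    k * (1 - χ / 2) * (w ⬝ᵥ ((Aᵀ * A) *ᵥ w)) ≤ w ⬝ᵥ (((B * A)ᵀ * (B * A)) *ᵥ w) := by
  have hk0 : (0 : ℝ) < k := by exact_mod_cast hk
  have hgram : w ⬝ᵥ ((Aᵀ * A) *ᵥ w) = (A *ᵥ w) ⬝ᵥ (A *ᵥ w) := by
    rw [← mulVec_mulVec, dotProduct_mulVec, vecMul_transpose]
  have hsketch : w ⬝ᵥ (((B * A)ᵀ * (B * A)) *ᵥ w) = (A *ᵥ w) ⬝ᵥ ((Bᵀ * B) *ᵥ (A *ᵥ w)) := by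
    rw [transpose_mul, Matrix.mul_assoc, ← mulVec_mulVec, dotProduct_mulVec, vecMul_transpose,
      ← Matrix.mul_assoc, ← mulVec_mulVec]
  have h := hB (A *ᵥ w) w
  have hnonneg : 0 ≤ (A *ᵥ w) ⬝ᵥ (A *ᵥ w) := by
    simpa using dotProduct_star_self_nonneg (A *ᵥ w)
  rw [mul_assoc, Real.mul_self_sqrt hnonneg, sub_mulVec, one_mulVec, smul_mulVec, dotProduct_sub,
    dotProduct_smul, smul_eq_mul, ← hsketch, ← hgram] at h
  have hlow := (abs_le.mp h).1
  calc k * (1 - χ / 2) * (w ⬝ᵥ ((Aᵀ * A) *ᵥ w))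
      ≤ k * ((k : ℝ)⁻¹ * (w ⬝ᵥ (((B * A)ᵀ * (B * A)) *ᵥ w))) := by
        rw [mul_assoc]
        exact mul_le_mul_of_nonneg_left (by linarith) hk0.le
    _ = w ⬝ᵥ (((B * A)ᵀ * (B * A)) *ᵥ w) := by field_simp

/-- under condition `A₁(A,χ,k)`, `(BA)ᵀ(BA)` is invertible and for every `v`,
`k²·‖((BA)ᵀ(BA))⁻¹v‖²_{AᵀA} ≤ (1/(1 − χ/2))²·‖v‖²/λ_min(AᵀA)`. -/
theorem stmt8 {n d k : ℕ} (hk : 1 ≤ k) (χ : ℝ) (hχ : χ ∈ Set.Ioc (0 : ℝ) 1)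
    (A : Matrix (Fin n) (Fin d) ℝ) (hA : (Aᵀ * A).PosDef)
    (B : Matrix (Fin k) (Fin n) ℝ) (hB : condA1 A χ k B) :
    IsUnit ((B * A)ᵀ * (B * A)).det ∧
      ∀ v : Fin d → ℝ,
        (k : ℝ) ^ 2 *
            ((((B * A)ᵀ * (B * A))⁻¹ *ᵥ v) ⬝ᵥ ((Aᵀ * A) *ᵥ (((B * A)ᵀ * (B * A))⁻¹ *ᵥ v))) ≤
          (1 / (1 - χ / 2)) ^ 2 * (v ⬝ᵥ v) / lambdaMin (Aᵀ * A) := by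
  have hk0 : (0 : ℝ) < k := by exact_mod_cast hk
  have hχ2 : 0 < 1 - χ / 2 := by linarith [hχ.2]
  have hc : 0 < k * (1 - χ / 2) := mul_pos hk0 hχ2
  have hpos : ∀ w : Fin d → ℝ, w ≠ 0 → 0 < w ⬝ᵥ ((Aᵀ * A) *ᵥ w) := fun w hw => by
    simpa using hA.dotProduct_mulVec_pos hw
  have hunit : IsUnit ((B * A)ᵀ * (B * A)).det := by
    rw [isUnit_iff_ne_zero]
    intro hdet
    obtain ⟨w, hw, hw0⟩ := exists_mulVec_eq_zero_iff.mpr hdet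
    have h := hB.gram_le hk w
    rw [hw0, dotProduct_zero] at h
    exact absurd h (not_le.mpr (mul_pos hc (hpos w hw)))
  refine ⟨hunit, fun v => ?_⟩
  set G := (B * A)ᵀ * (B * A) with hG
  set w := G⁻¹ *ᵥ v with hw
  have hGw : G *ᵥ w = v := by rw [hw, mulVec_mulVec, mul_nonsing_inv _ hunit, one_mulVec]
  rcases eq_or_ne w 0 with hw0 | hw0
  · have hv0 : v = 0 := by rw [← hGw, hw0, mulVec_zero]
    simp [hw0, hv0]
  have : NeZero d := ⟨by
    rintro rfl
    exact hw0 (Subsingleton.elim _ _)⟩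
  have hlam : 0 < lambdaMin (Aᵀ * A) := lambdaMin_pos hA
  have hray := lambdaMin_mul_le hA.posSemidef w
  have ha := hpos w hw0
  have hgram := hB.gram_le hk w
  rw [← hG, hGw] at hgram
  have hcs : (w ⬝ᵥ v) ^ 2 ≤ (w ⬝ᵥ w) * (v ⬝ᵥ v) := by
    simpa [dotProduct, sq] using Finset.sum_mul_sq_le_sq_mul_sq Finset.univ w v
  have hv : 0 ≤ v ⬝ᵥ v := by simpa using dotProduct_star_self_nonneg v
  set a := w ⬝ᵥ ((Aᵀ * A) *ᵥ w)
  set l := lambdaMin (Aᵀ * A)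
  have hsq : (k * (1 - χ / 2) * a) ^ 2 ≤ (w ⬝ᵥ w) * (v ⬝ᵥ v) :=
    (pow_le_pow_left₀ (mul_pos hc ha).le hgram 2).trans hcs
  have hmain : (k * (1 - χ / 2)) ^ 2 * a * l ≤ v ⬝ᵥ v := by
    refine le_of_mul_le_mul_left ?_ ha
    calc a * ((k * (1 - χ / 2)) ^ 2 * a * l) = l * (k * (1 - χ / 2) * a) ^ 2 := by ring
      _ ≤ l * ((w ⬝ᵥ w) * (v ⬝ᵥ v)) := by gcongr
      _ = l * (w ⬝ᵥ w) * (v ⬝ᵥ v) := by ring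
      _ ≤ a * (v ⬝ᵥ v) := by gcongr
  rw [le_div_iff₀ hlam, div_pow, one_pow, one_div_mul_eq_div, le_div_iff₀ (pow_pos hχ2 2)]
  calc (k : ℝ) ^ 2 * a * l * (1 - χ / 2) ^ 2 = (k * (1 - χ / 2)) ^ 2 * a * l := by ring
    _ ≤ v ⬝ᵥ v := hmain
end

section
/- Let C > 0, let X ∈ ℝ^{n×d} have rows x_1,…,x_n with ‖x_j‖ ≤ 1 for all j, let Y ∈ ℝ^n, and fix an index i ∈ {1,…,n}. Let X' be X with its i-th row replaced by the zero vector and Y' be Y with its i-th entry replaced by 0 (all other rows/entries unchanged). Then for every θ ∈ ℝ^d, ‖X'^⊤ clip_C(Y' − X'θ) − X^⊤ clip_C(Y − Xθ)‖ ≤ C. -/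
open Matrix

/-- Entrywise clipping at absolute level `C`: `x ↦ x·min{1, C/|x|}` (with `clip C 0 = 0`). -/
noncomputable def clip (C x : ℝ) : ℝ := x * min 1 (C / |x|)

/-- Clipping at level `C` produces values of absolute value at most `C`. -/
theorem abs_clip_le {C : ℝ} (hC : 0 ≤ C) (x : ℝ) : |clip C x| ≤ C := by
  rcases eq_or_ne x 0 with rfl | hx
  · simpa [clip] using hC
  have hmin : 0 ≤ min 1 (C / |x|) := by positivity
  rw [clip, abs_mul, abs_of_nonneg hmin]
  calc |x| * min 1 (C / |x|) ≤ |x| * (C / |x|) := by gcongr; exact min_le_right _ _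
    _ = C := mul_div_cancel₀ C (abs_ne_zero.mpr hx)

/-- sensitivity of the clipped gradient. Zeroing out the `i`-th row of `X`
and the `i`-th entry of `Y` changes `Xᵀ·clip_C(Y − Xθ)` by at most `C` in Euclidean norm,
for every `θ`. -/
theorem stmt11 {n d : ℕ} (C : ℝ) (hC : 0 < C)
    (X : Matrix (Fin n) (Fin d) ℝ) (hX : ∀ j : Fin n, Real.sqrt (X j ⬝ᵥ X j) ≤ 1)
    (Y : Fin n → ℝ) (i : Fin n) :
    ∀ θ : Fin d → ℝ,
      let X' : Matrix (Fin n) (Fin d) ℝ := X.updateRow i 0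
      let Y' : Fin n → ℝ := Function.update Y i 0
      let w : Fin d → ℝ :=
        X'ᵀ *ᵥ (fun j => clip C ((Y' - X' *ᵥ θ) j)) -
          Xᵀ *ᵥ (fun j => clip C ((Y - X *ᵥ θ) j))
      Real.sqrt (w ⬝ᵥ w) ≤ C := by
  intro θ X' Y' w
  set c := clip C ((Y - X *ᵥ θ) i)
  have hw : w = -c • X i := by
    ext k
    simp only [w, mulVec, dotProduct, Pi.sub_apply, ← Finset.sum_sub_distrib, transpose_apply]
    rw [Finset.sum_eq_single i]
    · simp [X', c, mulVec, dotProduct, mul_comm]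
    · intro j _ hj
      simp [X', Y', hj, updateRow_ne]
    · simp
  have hsq : w ⬝ᵥ w = c ^ 2 * (X i ⬝ᵥ X i) := by
    rw [hw, smul_dotProduct, dotProduct_smul, smul_eq_mul, smul_eq_mul]
    ring
  rw [hsq, Real.sqrt_mul (sq_nonneg c), Real.sqrt_sq_eq_abs]
  calc |c| * √(X i ⬝ᵥ X i) ≤ C * 1 := by
        gcongr
        exacts [abs_clip_le hC.le _, hX i]
    _ = C := mul_one C
end

section
/- Let X ∈ ℝ^{n×d} with X^⊤X invertible, Y ∈ ℝ^n, η ≥ 0, and χ ∈ (0,1]. Let L(θ) := ‖Y − Xθ‖², θ* := (X^⊤X)^{-1}X^⊤Y, and θ*(η²) := (X^⊤X + η²·I_d)^{-1}X^⊤Y. Suppose θ ∈ ℝ^d satisfies L(θ) + η²·‖θ‖² + η² ≤ (1 + χ)² · ( L(θ*(η²)) + η²·‖θ*(η²)‖² + η² ). Then L(θ) − L(θ*) ≤ 3χ·(η² + L(θ*)) + 4η²·‖θ*‖². -/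
open Matrix

/-- A solution of the ridge normal equations minimizes the ridge objective. -/
theorem ridge_objective_le_of_normal_eq {m k : Type*} [Fintype m] [Fintype k]
    (X : Matrix m k ℝ) (Y : m → ℝ) {a : ℝ} (ha : 0 ≤ a) {t : k → ℝ}
    (ht : Xᵀ *ᵥ (X *ᵥ t) + a • t = Xᵀ *ᵥ Y) (s : k → ℝ) :
    (Y - X *ᵥ t) ⬝ᵥ (Y - X *ᵥ t) + a * (t ⬝ᵥ t) ≤
      (Y - X *ᵥ s) ⬝ᵥ (Y - X *ᵥ s) + a * (s ⬝ᵥ s) := by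
  obtain ⟨δ, rfl⟩ : ∃ δ, s = t + δ := ⟨s - t, by abel⟩
  have hnormal := congrArg (δ ⬝ᵥ ·) ht
  simp only [dotProduct_add, dotProduct_smul, smul_eq_mul, dotProduct_mulVec,
    vecMul_transpose] at hnormal
  have hX : 0 ≤ (X *ᵥ δ) ⬝ᵥ (X *ᵥ δ) := dotProduct_self_star_nonneg (X *ᵥ δ)
  have hδ : 0 ≤ a * (δ ⬝ᵥ δ) := mul_nonneg ha (dotProduct_self_star_nonneg δ)
  simp only [mulVec_add, dotProduct_add, add_dotProduct, dotProduct_sub, sub_dotProduct]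
  rw [← dotProduct_mulVec] at hnormal
  rw [dotProduct_comm (X *ᵥ t) (X *ᵥ δ), dotProduct_comm Y (X *ᵥ δ), dotProduct_comm t δ]
  linarith

/-- The ridge Gram matrix is invertible whenever the Gram matrix is. -/
theorem isUnit_det_gram_add_smul_one {m k : Type*} [Fintype m] [Fintype k] [DecidableEq k]
    (X : Matrix m k ℝ) (hX : IsUnit (Xᵀ * X).det) {a : ℝ} (ha : 0 ≤ a) :
    IsUnit (Xᵀ * X + a • (1 : Matrix k k ℝ)).det := by
  have hsemi : (Xᵀ * X).PosSemidef := by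
    simpa [conjTranspose_eq_transpose_of_trivial] using posSemidef_conjTranspose_mul_self X
  have hpos : (Xᵀ * X).PosDef :=
    hsemi.posDef_iff_isUnit.mpr ((isUnit_iff_isUnit_det _).mpr hX)
  exact (hpos.add_posSemidef (PosSemidef.one.smul ha)).det_pos.ne'.isUnit

/-- if `θ` satisfies the sketched-objective guarantee
`L(θ) + η²‖θ‖² + η² ≤ (1+χ)²·(L(θ*(η²)) + η²‖θ*(η²)‖² + η²)`, then
`L(θ) − L(θ*) ≤ 3χ·(η² + L(θ*)) + 4η²·‖θ*‖²`. -/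
theorem stmt15 {n d : ℕ} (X : Matrix (Fin n) (Fin d) ℝ) (hX : IsUnit (Xᵀ * X).det)
    (Y : Fin n → ℝ) (η : ℝ) (hη : 0 ≤ η) (χ : ℝ) (hχ : χ ∈ Set.Ioc (0 : ℝ) 1)
    (θ : Fin d → ℝ) :
    let L : (Fin d → ℝ) → ℝ := fun t => (Y - X *ᵥ t) ⬝ᵥ (Y - X *ᵥ t)
    let θs : Fin d → ℝ := (Xᵀ * X)⁻¹ *ᵥ (Xᵀ *ᵥ Y)
    let θη : Fin d → ℝ :=
      (Xᵀ * X + η ^ 2 • (1 : Matrix (Fin d) (Fin d) ℝ))⁻¹ *ᵥ (Xᵀ *ᵥ Y)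
    L θ + η ^ 2 * (θ ⬝ᵥ θ) + η ^ 2 ≤
        (1 + χ) ^ 2 * (L θη + η ^ 2 * (θη ⬝ᵥ θη) + η ^ 2) →
      L θ - L θs ≤ 3 * χ * (η ^ 2 + L θs) + 4 * η ^ 2 * (θs ⬝ᵥ θs) := by
  intro L θs θη h
  have ha : 0 ≤ η ^ 2 := sq_nonneg η
  have hnormal : Xᵀ *ᵥ (X *ᵥ θη) + η ^ 2 • θη = Xᵀ *ᵥ Y := by
    have hsolve : (Xᵀ * X + η ^ 2 • (1 : Matrix (Fin d) (Fin d) ℝ)) *ᵥ θη = Xᵀ *ᵥ Y := by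
      rw [mulVec_mulVec, mul_nonsing_inv _ (isUnit_det_gram_add_smul_one X hX ha), one_mulVec]
    simpa [add_mulVec, smul_mulVec, mulVec_mulVec] using hsolve
  have hmin : L θη + η ^ 2 * (θη ⬝ᵥ θη) ≤ L θs + η ^ 2 * (θs ⬝ᵥ θs) :=
    ridge_objective_le_of_normal_eq X Y ha hnormal θs
  have hL : 0 ≤ L θs := dotProduct_self_star_nonneg (Y - X *ᵥ θs)
  have hs : 0 ≤ η ^ 2 * (θs ⬝ᵥ θs) := mul_nonneg ha (dotProduct_self_star_nonneg θs)
  have hθ : 0 ≤ η ^ 2 * (θ ⬝ᵥ θ) := mul_nonneg ha (dotProduct_self_star_nonneg θ)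
  obtain ⟨hχ0, hχ1⟩ := hχ
  have hχsq : (1 + χ) ^ 2 ≤ 1 + 3 * χ := by nlinarith
  have hbound : (1 + χ) ^ 2 * (L θη + η ^ 2 * (θη ⬝ᵥ θη) + η ^ 2) ≤
      (1 + 3 * χ) * (L θs + η ^ 2 * (θs ⬝ᵥ θs) + η ^ 2) :=
    (mul_le_mul_of_nonneg_left (by linarith) (sq_nonneg _)).trans
      (mul_le_mul_of_nonneg_right hχsq (by linarith))
  have hχs : χ * (η ^ 2 * (θs ⬝ᵥ θs)) ≤ η ^ 2 * (θs ⬝ᵥ θs) := mul_le_of_le_one_left hs hχ1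
  linarith
end
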